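/- arXiv:2508.09947 — 3 statements merged into one kernel-verified Lean document; each statement's English description precedes it below -/
import Mathlib

section
/- Let λ be a positive real number that is an algebraic integer of degree 2 over ℚ. Then κ(λ) < ∞ if and only if λ is a totally real algebraic integer and λ is greater than or equal to the absolute value of its algebraic conjugate (the other root of its minimal polynomial). -/
open Polynomial

/-- The largest real eigenvalue of a real matrix (via `sSup` of the set of eigenvalues). -/
noncomputable def largestEig {V : Type} [Fintype V] [DecidableEq V] (M : Matrix V V ℝ) : ℝ :=
  sSup {μ : ℝ | Module.End.HasEigenvalue (Matrix.toLin' M) μ}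

/-- The spectral radius of a finite simple graph: the largest eigenvalue of its adjacency
matrix. -/
noncomputable def specRad {V : Type} [Fintype V] [DecidableEq V] (G : SimpleGraph V) : ℝ :=
  letI := Classical.decRel G.Adj
  largestEig (G.adjMatrix ℝ)

/-- The spectral radius order `κ(λ)`: the least number of vertices of a finite simple graph
with spectral radius `λ`, or `⊤` if there is no such graph. -/
noncomputable def kappa (lam : ℝ) : ℕ∞ :=
  sInf {m : ℕ∞ | ∃ n : ℕ, m = (n : ℕ∞) ∧ ∃ G : SimpleGraph (Fin n), specRad G = lam}

/-- A real number is a totally real algebraic integer if it is a root of a monic integer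
polynomial all of whose complex roots are real. -/
def IsTotallyRealAlgInt (x : ℝ) : Prop :=
  ∃ p : Polynomial ℤ, p.Monic ∧ Polynomial.aeval x p = 0 ∧
    ∀ z : ℂ, Polynomial.aeval z p = 0 → z.im = 0

/-- The integer coefficients of the minimal polynomial. -/
lemma quad_coeffs (lam : ℝ) (hint : IsIntegral ℤ lam) (hdeg : (minpoly ℚ lam).natDegree = 2) :
    ∃ a b : ℤ, minpoly ℚ lam = X ^ 2 - C (a : ℚ) * X - C (b : ℚ) := by
  have h1 := minpoly.isIntegrallyClosed_eq_field_fractions' ℚ hint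
  have hm := minpoly.monic hint
  have hd : (minpoly ℤ lam).natDegree = 2 := by
    rw [← hdeg, h1, hm.natDegree_map]
  refine ⟨-(minpoly ℤ lam).coeff 1, -(minpoly ℤ lam).coeff 0, ?_⟩
  have hc : (minpoly ℤ lam).coeff 2 = 1 := by
    have := hm.coeff_natDegree
    rwa [hd] at this
  rw [h1]
  conv_lhs => rw [(minpoly ℤ lam).as_sum_range, hd]
  simp [Finset.sum_range_succ, hc, ← C_mul_X_pow_eq_monomial]
  ring

lemma quad_not_int (lam : ℝ) (hdeg : (minpoly ℚ lam).natDegree = 2) (m : ℤ) : lam ≠ m := by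
  rintro rfl
  have : (minpoly ℚ ((m : ℝ))) = X - C (m : ℚ) := by
    have := minpoly.eq_X_sub_C ℝ (m : ℚ)
    simpa using this
  rw [this, natDegree_X_sub_C] at hdeg
  omega

/-- A nonnegative symmetric matrix with a positive eigenvector. -/
lemma largestEig_eq {V : Type} [Fintype V] [DecidableEq V] [Nonempty V] (M : Matrix V V ℝ)
    (hM : ∀ i j, 0 ≤ M i j) (hs : M.transpose = M) (v : V → ℝ) (hv : ∀ i, 0 < v i) (lam : ℝ)
    (he : M.mulVec v = lam • v) : largestEig M = lam := by
  have hmem : Module.End.HasEigenvalue (Matrix.toLin' M) lam := by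
    apply Module.End.hasEigenvalue_of_hasEigenvector (x := v)
    refine ⟨Module.End.mem_eigenspace_iff.2 (by simpa using he), ?_⟩
    intro h0
    obtain ⟨i⟩ := ‹Nonempty V›
    have := hv i
    simp [h0] at this
  unfold largestEig
  apply IsGreatest.csSup_eq
  refine ⟨hmem, ?_⟩
  intro μ hμ
  obtain ⟨w, hw, hw0⟩ := hμ.exists_hasEigenvector
  rw [Module.End.mem_eigenspace_iff, Matrix.toLin'_apply] at hw
  have key : ∀ i, μ * |w i| ≤ M.mulVec (fun j => |w j|) i := by
    intro i
    have h := congrFun hw i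
    calc μ * |w i| ≤ |μ * w i| := by
          rw [abs_mul]; exact mul_le_mul_of_nonneg_right (le_abs_self _) (abs_nonneg _)
      _ = |M.mulVec w i| := by rw [h]; simp
      _ ≤ ∑ j, |M i j * w j| := by
          simp only [Matrix.mulVec, dotProduct]; exact Finset.abs_sum_le_sum_abs _ _
      _ = _ := by
          simp only [Matrix.mulVec, dotProduct, abs_mul, abs_of_nonneg (hM _ _)]
  have hsum : μ * ∑ i, v i * |w i| ≤ lam * ∑ i, v i * |w i| := by
    calc μ * ∑ i, v i * |w i| = ∑ i, v i * (μ * |w i|) := by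
          rw [Finset.mul_sum]; exact Finset.sum_congr rfl fun i _ => by ring
      _ ≤ ∑ i, v i * M.mulVec (fun j => |w j|) i :=
          Finset.sum_le_sum fun i _ => mul_le_mul_of_nonneg_left (key i) (hv i).le
      _ = v ⬝ᵥ M.mulVec (fun j => |w j|) := rfl
      _ = (M.mulVec v) ⬝ᵥ (fun j => |w j|) := by
          rw [Matrix.dotProduct_mulVec, ← Matrix.mulVec_transpose, hs]
      _ = lam * ∑ i, v i * |w i| := by
          rw [he]; simp [dotProduct, Finset.mul_sum, mul_assoc]
  have hp : 0 < ∑ i, v i * |w i| := by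
    obtain ⟨i, hi⟩ := Function.ne_iff.1 hw0
    apply Finset.sum_pos' (fun i _ => mul_nonneg (hv i).le (abs_nonneg _))
    exact ⟨i, Finset.mem_univ _, mul_pos (hv i) (abs_pos.2 hi)⟩
  exact le_of_mul_le_mul_right hsum hp

/-- The adjacency relation of the construction. -/
def cAdj (p s N : ℕ) :
    Fin (p + 1) × Fin (s + 1) × Option (Fin N) → Fin (p + 1) × Fin (s + 1) × Option (Fin N) → Prop
  | (i, j, none), (i', j', none) => i ≠ i' ∧ j = j'
  | (i, j, none), (i', j', some _) => i = i' ∧ j = j'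
  | (i, j, some _), (i', j', none) => i = i' ∧ j = j'
  | (i, j, some k), (i', j', some k') => i = i' ∧ k = k' ∧ j ≠ j'

/-- The graph of the construction. -/
def cGraph (p s N : ℕ) : SimpleGraph (Fin (p + 1) × Fin (s + 1) × Option (Fin N)) where
  Adj := cAdj p s N
  symm := ⟨by
    rintro ⟨i, j, _ | k⟩ ⟨i', j', _ | k'⟩ <;> simp only [cAdj] <;> grind⟩
  loopless := ⟨by
    rintro ⟨i, j, _ | k⟩ <;> simp [cAdj]⟩

lemma cGraph_adj (p s N : ℕ) (x y) : (cGraph p s N).Adj x y ↔ cAdj p s N x y := Iff.rfl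

lemma sum_ne_const {n : ℕ} (i : Fin (n + 1)) (c : ℝ) :
    ∑ x : Fin (n + 1), (if i = x then 0 else c) = n * c := by
  have h : ∀ x : Fin (n + 1), (if i = x then 0 else c) = c - (if i = x then c else 0) := by
    intro x; split_ifs <;> simp
  simp only [h, Finset.sum_sub_distrib, Finset.sum_ite_eq]
  simp; ring

open Classical in
lemma cGraph_mulVec (p s N : ℕ) (lam : ℝ) (h : (lam - p) * (lam - s) = N) :
    ((cGraph p s N).adjMatrix ℝ).mulVec
      (fun x => if x.2.2 = none then lam - s else 1) =
      lam • (fun x => if x.2.2 = none then lam - s else 1) := by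
  funext x
  rcases x with ⟨i, j, _ | k⟩
  · simp only [Matrix.mulVec, dotProduct, SimpleGraph.adjMatrix_apply, Fintype.sum_prod_type,
      Fintype.sum_option, cGraph_adj, cAdj]
    have e : ∀ x : Fin (p+1), ∀ y : Fin (s+1), ∀ inst : Decidable (i ≠ x ∧ j = y),
      @ite ℝ (i ≠ x ∧ j = y) inst 1 0 =
      if j = y then (if i = x then 0 else 1) else 0 := by
      intros; split_ifs <;> grind
    have e' : ∀ x : Fin (p+1), ∀ y : Fin (s+1), ∀ inst : Decidable (i = x ∧ j = y),
      @ite ℝ (i = x ∧ j = y) inst 1 0 =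
      if j = y then (if i = x then 1 else 0) else 0 := by
      intros; split_ifs <;> grind
    simp only [e, e']
    simp [Finset.sum_add_distrib, sum_ne_const, ite_mul]
    linarith
  · simp only [Matrix.mulVec, dotProduct, SimpleGraph.adjMatrix_apply, Fintype.sum_prod_type,
      Fintype.sum_option, cGraph_adj, cAdj]
    have e : ∀ x : Fin (p+1), ∀ y : Fin (s+1), ∀ z : Fin N,
      ∀ inst : Decidable (i = x ∧ k = z ∧ j ≠ y),
      @ite ℝ (i = x ∧ k = z ∧ j ≠ y) inst 1 0 =
      if k = z then (if i = x then (if j = y then 0 else 1) else 0) else 0 := by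
      intros; split_ifs <;> grind
    have e' : ∀ x : Fin (p+1), ∀ y : Fin (s+1), ∀ inst : Decidable (i = x ∧ j = y),
      @ite ℝ (i = x ∧ j = y) inst 1 0 =
      if j = y then (if i = x then 1 else 0) else 0 := by
      intros; split_ifs <;> grind
    have e2 : ∀ x : Fin (p+1), ∑ y : Fin (s+1), (if i = x then (if j = y then (0:ℝ) else 1) else 0)
      = if i = x then (s:ℝ) else 0 := by
      intro x; split_ifs
      · simpa using sum_ne_const j 1
      · simp
    simp only [e, e']
    simp [e2, Finset.sum_add_distrib, ite_mul]

lemma kappa_lt_of_graph {V : Type} [Fintype V] [DecidableEq V] [Nonempty V] (G : SimpleGraph V)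
    [DecidableRel G.Adj] (v : V → ℝ) (hv : ∀ i, 0 < v i) (lam : ℝ)
    (he : (G.adjMatrix ℝ).mulVec v = lam • v) : kappa lam < ⊤ := by
  classical
  let e := Fintype.equivFin V
  have : Nonempty (Fin (Fintype.card V)) := ⟨e (Classical.arbitrary V)⟩
  have hsr : specRad (G.comap e.symm) = lam := by
    unfold specRad
    apply largestEig_eq _ _ _ (fun x => v (e.symm x)) (fun x => hv _)
    · funext i
      have h := congrFun he (e.symm i)
      simp only [Matrix.mulVec, dotProduct, SimpleGraph.adjMatrix_apply, Pi.smul_apply] at h ⊢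
      rw [← h, ← e.symm.sum_comp]
      refine Finset.sum_congr rfl fun j _ => ?_
      simp only [SimpleGraph.comap_adj]
    · intro i j
      simp only [SimpleGraph.adjMatrix_apply]
      split_ifs <;> norm_num
    · exact @SimpleGraph.transpose_adjMatrix _ _ _ (Classical.decRel _) _ _
  refine lt_of_le_of_lt (sInf_le ⟨_, rfl, _, hsr⟩) (ENat.natCast_lt_top _)

/-- Perron bound: all real eigenvalues are bounded by the largest one in absolute value. -/
lemma perron {V : Type} [Fintype V] [DecidableEq V] (M : Matrix V V ℝ)
    (hM : ∀ i j, 0 ≤ M i j) (hs : M.IsHermitian) (lam : ℝ)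
    (hmax : ∀ μ, Module.End.HasEigenvalue (Matrix.toLin' M) μ → μ ≤ lam) (μ : ℝ)
    (hμ : Module.End.HasEigenvalue (Matrix.toLin' M) μ) : |μ| ≤ lam := by
  have hB : (lam • (1 : Matrix V V ℝ) - M).IsHermitian := by
    apply Matrix.IsHermitian.sub _ hs
    simp [Matrix.IsHermitian]
  have hpsd : (lam • (1 : Matrix V V ℝ) - M).PosSemidef := by
    rw [hB.posSemidef_iff_eigenvalues_nonneg]
    intro i
    have h := hB.mulVec_eigenvectorBasis i
    have := hmax (lam - hB.eigenvalues i) (by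
      apply Module.End.hasEigenvalue_of_hasEigenvector
        (x := (hB.eigenvectorBasis i).ofLp)
      refine ⟨Module.End.mem_eigenspace_iff.2 ?_, ?_⟩
      · rw [Matrix.sub_mulVec, Matrix.smul_mulVec, Matrix.one_mulVec] at h
        rw [Matrix.toLin'_apply, sub_smul, ← h]
        simp
      · intro h0
        have := hB.eigenvectorBasis.orthonormal.ne_zero i
        exact this (by ext j; simpa using congrFun h0 j))
    simp only [Pi.zero_apply]
    linarith
  obtain ⟨w, hw, hw0⟩ := hμ.exists_hasEigenvector
  rw [Module.End.mem_eigenspace_iff, Matrix.toLin'_apply] at hw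
  have key : ∀ i, |μ| * |w i| ≤ M.mulVec (fun j => |w j|) i := by
    intro i
    have h := congrFun hw i
    calc |μ| * |w i| = |M.mulVec w i| := by rw [h]; simp [abs_mul]
      _ ≤ ∑ j, |M i j * w j| := by
          simp only [Matrix.mulVec, dotProduct]; exact Finset.abs_sum_le_sum_abs _ _
      _ = _ := by
          simp only [Matrix.mulVec, dotProduct, abs_mul, abs_of_nonneg (hM _ _)]
  have h1 := hpsd.dotProduct_mulVec_nonneg (fun j => |w j|)
  rw [Matrix.sub_mulVec, Matrix.smul_mulVec, Matrix.one_mulVec, dotProduct_sub] at h1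
  have h2 : |μ| * ∑ i, |w i| * |w i| ≤ lam * ∑ i, |w i| * |w i| := by
    calc |μ| * ∑ i, |w i| * |w i| = ∑ i, |w i| * (|μ| * |w i|) := by
          rw [Finset.mul_sum]; exact Finset.sum_congr rfl fun i _ => by ring
      _ ≤ ∑ i, |w i| * M.mulVec (fun j => |w j|) i :=
          Finset.sum_le_sum fun i _ => mul_le_mul_of_nonneg_left (key i) (abs_nonneg _)
      _ ≤ lam * ∑ i, |w i| * |w i| := by
          simp only [dotProduct_smul, smul_eq_mul] at h1
          simpa [dotProduct] using h1
  have hp : 0 < ∑ i, |w i| * |w i| := by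
    obtain ⟨i, hi⟩ := Function.ne_iff.1 hw0
    apply Finset.sum_pos' (fun i _ => mul_nonneg (abs_nonneg _) (abs_nonneg _))
    exact ⟨i, Finset.mem_univ _, mul_pos (abs_pos.2 hi) (abs_pos.2 hi)⟩
  exact le_of_mul_le_mul_right h2 hp

lemma conj_bound (lam : ℝ) (hpos : 0 < lam) (hk : kappa lam < ⊤) (z : ℝ)
    (hz : Polynomial.aeval z (minpoly ℚ lam) = 0) : |z| ≤ lam := by
  classical
  obtain ⟨m, ⟨n, -, G, hG⟩, -⟩ := sInf_lt_iff.1 hk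
  unfold specRad largestEig at hG
  set M : Matrix (Fin n) (Fin n) ℝ := @SimpleGraph.adjMatrix ℝ (Fin n) G (Classical.decRel G.Adj) _ _
    with hMdef
  change sSup {μ : ℝ | Module.End.HasEigenvalue (Matrix.toLin' M) μ} = lam at hG
  have hfin : {μ : ℝ | Module.End.HasEigenvalue (Matrix.toLin' M) μ}.Finite :=
    Module.End.finite_hasEigenvalue _
  have hne : {μ : ℝ | Module.End.HasEigenvalue (Matrix.toLin' M) μ}.Nonempty := by
    by_contra h
    rw [Set.not_nonempty_iff_eq_empty] at h
    rw [h, Real.sSup_empty] at hG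
    linarith
  have hlam : Module.End.HasEigenvalue (Matrix.toLin' M) lam := by
    have := hne.csSup_mem hfin
    rwa [hG] at this
  have hmax : ∀ μ, Module.End.HasEigenvalue (Matrix.toLin' M) μ → μ ≤ lam := by
    intro μ hμ
    rw [← hG]
    exact le_csSup hfin.bddAbove hμ
  letI := Classical.decRel G.Adj
  have hmap : M = (G.adjMatrix ℚ).map (algebraMap ℚ ℝ) := by
    ext i j
    simp only [hMdef, SimpleGraph.adjMatrix_apply, Matrix.map_apply]
    split_ifs <;> simp
  have hroot : ∀ μ : ℝ, Module.End.HasEigenvalue (Matrix.toLin' M) μ ↔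
      Polynomial.aeval μ (G.adjMatrix ℚ).charpoly = 0 := by
    intro μ
    rw [Module.End.hasEigenvalue_iff_isRoot_charpoly, Matrix.charpoly_toLin', hmap,
      Matrix.charpoly_map, IsRoot, eval_map_algebraMap]
  refine perron M ?_ ?_ lam hmax z ?_
  · intro i j
    simp only [hMdef, SimpleGraph.adjMatrix_apply]
    split_ifs <;> norm_num
  · rw [Matrix.IsHermitian, Matrix.conjTranspose_eq_transpose_of_trivial]
    exact SimpleGraph.transpose_adjMatrix _
  · rw [hroot]
    obtain ⟨r, hr⟩ := minpoly.dvd ℚ lam ((hroot lam).1 hlam)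
    rw [hr, map_mul, hz, zero_mul]

/-- For a positive quadratic algebraic integer `λ`, we have `κ(λ) < ∞` if and only if `λ` is a
totally real algebraic integer which dominates the absolute values of its algebraic
conjugates (the roots of its minimal polynomial over `ℚ`). -/
theorem quadratic_kappa_finite_iff (lam : ℝ) (hpos : 0 < lam)
    (hint : IsIntegral ℤ lam) (hdeg : (minpoly ℚ lam).natDegree = 2) :
    kappa lam < ⊤ ↔
      (IsTotallyRealAlgInt lam ∧
        ∀ z : ℂ, Polynomial.aeval z (minpoly ℚ lam) = 0 → ‖z‖ ≤ lam) := by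
  obtain ⟨a, b, hab⟩ := quad_coeffs lam hint hdeg
  have hl : lam ^ 2 - a * lam - b = 0 := by
    have := minpoly.aeval ℚ lam
    rw [hab] at this
    simpa using this
  have hroots : ∀ z : ℂ, z ^ 2 - a * z - b = 0 → z = (lam : ℝ) ∨ z = ((a - lam : ℝ) : ℂ) := by
    intro z hz
    have hl' : (lam : ℂ) ^ 2 - a * lam - b = 0 := by exact_mod_cast hl
    have : (z - lam) * (z - (a - lam)) = 0 := by linear_combination hz - hl'
    rcases mul_eq_zero.1 this with h | h
    · left; linear_combination h
    · right; push_cast; linear_combination h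
  constructor
  · intro hk
    refine ⟨⟨X ^ 2 - C a * X - C b, ?_, ?_, ?_⟩, ?_⟩
    · monicity!
    · simpa using hl
    · intro z hz
      rcases hroots z (by simpa using hz) with rfl | rfl <;> exact Complex.ofReal_im _
    · intro z hz
      rw [hab] at hz
      have hb : |(a - lam : ℝ)| ≤ lam := by
        apply conj_bound lam hpos hk
        rw [hab]
        simp
        linear_combination hl
      rcases hroots z (by simpa using hz) with rfl | rfl
      · rw [Complex.norm_real, Real.norm_eq_abs, abs_of_pos hpos]
      · rw [Complex.norm_real, Real.norm_eq_abs]; exact hb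
  · rintro ⟨-, hz⟩
    have hb : |(a - lam : ℝ)| ≤ lam := by
      have hl' : (lam : ℂ) ^ 2 - a * lam - b = 0 := by exact_mod_cast hl
      have := hz ((a - lam : ℝ) : ℂ) (by
        rw [hab]; simp; linear_combination hl')
      rwa [Complex.norm_real, Real.norm_eq_abs] at this
    rw [abs_le] at hb
    have ha : 0 ≤ a := by
      have : (0 : ℝ) ≤ a := by linarith
      exact_mod_cast this
    obtain ⟨p, s, hps, hle, hle'⟩ : ∃ p s : ℕ, (p + s : ℤ) = a ∧ p ≤ s ∧ s ≤ p + 1 :=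
      ⟨(a / 2).toNat, (a - a / 2).toNat, by omega, by omega, by omega⟩
    have hps' : (p + s : ℝ) = a := by exact_mod_cast hps
    have hleR : (p : ℝ) ≤ s := by exact_mod_cast hle
    have hleR' : (s : ℝ) ≤ p + 1 := by exact_mod_cast hle'
    have hprod : (lam - p) * (lam - s) = ((p * s + b : ℤ) : ℝ) := by
      push_cast
      linear_combination hl - lam * hps'
    have hN0 : (-1 : ℤ) < p * s + b := by
      have : (-1 : ℝ) < ((p * s + b : ℤ) : ℝ) := by
        rw [← hprod]
        nlinarith [sq_nonneg (2 * lam - p - s)]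
      exact_mod_cast this
    have hpne : lam - p ≠ 0 := sub_ne_zero.2 (by simpa using quad_not_int lam hdeg p)
    have hsne : lam - s ≠ 0 := sub_ne_zero.2 (by simpa using quad_not_int lam hdeg s)
    have hN1 : (p * s + b : ℤ) ≠ 0 := by
      intro h0
      rw [h0, Int.cast_zero] at hprod
      exact mul_ne_zero hpne hsne hprod
    obtain ⟨N, hN⟩ : ∃ N : ℕ, (p * s + b : ℤ) = N := ⟨(p * s + b : ℤ).toNat, by omega⟩
    have hNpos : 0 < (N : ℝ) := by
      have : 0 < N := by omega
      exact_mod_cast this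
    rw [hN, Int.cast_natCast] at hprod
    have hp0 : 0 < lam - p := lt_of_le_of_ne (by linarith) hpne.symm
    have hs0 : 0 < lam - s := by
      rw [← hprod] at hNpos
      exact (mul_pos_iff_of_pos_left hp0).1 hNpos
    classical
    refine kappa_lt_of_graph (cGraph p s N) _ ?_ lam (cGraph_mulVec p s N lam hprod)
    intro x
    split_ifs
    · exact hs0
    · exact one_pos
end

section
/- Let λ be a real number with 0 < λ ≤ 2. Then κ(λ) < ∞ if and only if λ is a totally real algebraic integer and λ is greater than or equal to the absolute value of every algebraic conjugate of λ. -/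
open Polynomial

theorem largestEig_of_pos {V : Type} [Fintype V] [DecidableEq V] [Nonempty V]
    (M : Matrix V V ℝ) (hM : ∀ i j, 0 ≤ M i j) (v : V → ℝ) (hv : ∀ i, 0 < v i) (c : ℝ)
    (h : M.mulVec v = c • v) : largestEig M = c := by
  unfold largestEig
  apply IsGreatest.csSup_eq
  constructor
  · refine Module.End.hasEigenvalue_of_hasEigenvector (x := v) ⟨?_, ?_⟩
    · rw [Module.End.mem_eigenspace_iff, Matrix.toLin'_apply, h]
    · intro h0
      obtain ⟨i⟩ := ‹Nonempty V›
      have := hv i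
      simp [h0] at this
  · intro μ hμ
    obtain ⟨u, hu, hu0⟩ := Module.End.HasEigenvalue.exists_hasEigenvector hμ
    rw [Module.End.mem_eigenspace_iff, Matrix.toLin'_apply] at hu
    obtain ⟨i, hi⟩ := Finite.exists_max (fun i => |u i| / v i)
    have hpos : 0 < |u i| := by
      obtain ⟨j, hj⟩ := Function.ne_iff.mp hu0
      have h1 : 0 < |u j| / v j := div_pos (abs_pos.mpr hj) (hv j)
      have h2 := lt_of_lt_of_le h1 (hi j)
      by_contra hc
      have h3 : |u i| = 0 := le_antisymm (not_lt.mp hc) (abs_nonneg _)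
      simp [h3] at h2
    have hb : ∀ j, |u j| ≤ |u i| / v i * v j := by
      intro j
      have := hi j
      rwa [div_le_iff₀ (hv j)] at this
    have e1 : ∑ j, M i j * u j = μ * u i := by
      simpa [Matrix.mulVec, dotProduct] using congrFun hu i
    have e2 : ∑ j, M i j * v j = c * v i := by
      simpa [Matrix.mulVec, dotProduct] using congrFun h i
    have : μ * |u i| ≤ c * |u i| := by
      calc μ * |u i| ≤ |μ * u i| := by
            rw [abs_mul]; exact mul_le_mul_of_nonneg_right (le_abs_self _) (abs_nonneg _)
        _ = |∑ j, M i j * u j| := by rw [e1]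
        _ ≤ ∑ j, |M i j * u j| := Finset.abs_sum_le_sum_abs _ _
        _ ≤ ∑ j, |u i| / v i * (M i j * v j) := by
            apply Finset.sum_le_sum
            intro j _
            rw [abs_mul, abs_of_nonneg (hM i j)]
            calc M i j * |u j| ≤ M i j * (|u i| / v i * v j) :=
                  mul_le_mul_of_nonneg_left (hb j) (hM i j)
              _ = _ := by ring
        _ = c * |u i| := by
            rw [← Finset.mul_sum, e2]
            have := (hv i).ne'
            field_simp
    exact le_of_mul_le_mul_right this hpos

theorem specRad_of_pos {V : Type} [Fintype V] [DecidableEq V] [Nonempty V]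
    (G : SimpleGraph V) (v : V → ℝ) (hv : ∀ i, 0 < v i) (c : ℝ)
    (h : ∀ i, (letI := Classical.decRel G.Adj; ∑ j, if G.Adj i j then v j else 0) = c * v i) :
    specRad G = c := by
  unfold specRad
  let := Classical.decRel G.Adj
  apply largestEig_of_pos _ _ v hv
  · ext i
    have := h i
    simp only [Matrix.mulVec, dotProduct, SimpleGraph.adjMatrix_apply, ite_mul, one_mul, zero_mul,
      Pi.smul_apply, smul_eq_mul]
    convert this
  · intro i j
    rw [SimpleGraph.adjMatrix_apply]
    split_ifs <;> norm_num

theorem kappa_lt_top_iff (lam : ℝ) :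
    kappa lam < ⊤ ↔ ∃ n : ℕ, ∃ G : SimpleGraph (Fin n), specRad G = lam := by
  unfold kappa
  rw [sInf_lt_iff]
  constructor
  · rintro ⟨m, ⟨n, -, h⟩, -⟩
    exact ⟨n, h⟩
  · rintro ⟨n, h⟩
    exact ⟨n, ⟨n, rfl, h⟩, ENat.natCast_lt_top n⟩

theorem kappa_two : kappa 2 < ⊤ := by
  rw [kappa_lt_top_iff]
  refine ⟨3, ⊤, specRad_of_pos _ (fun _ => 1) (fun _ => one_pos) _ ?_⟩
  intro i
  simp only [SimpleGraph.top_adj]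
  fin_cases i <;> simp [Fin.sum_univ_three] <;> norm_num

theorem path_sum (N : ℕ) (t : ℝ) (htN : t * (N + 1) = Real.pi) (i : Fin N) :
    ∑ j : Fin N, (if (i : ℕ) + 1 = j ∨ (j : ℕ) + 1 = i then
        Real.sin (t * ((j : ℕ) + 1)) else 0) = 2 * Real.cos t * Real.sin (t * ((i : ℕ) + 1)) := by
  have key : ∀ j : Fin N, (if (i : ℕ) + 1 = j ∨ (j : ℕ) + 1 = i then
      Real.sin (t * ((j : ℕ) + 1)) else 0) =
      (if (j : ℕ) = i + 1 then Real.sin (t * ((j : ℕ) + 1)) else 0) +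
      (if (j : ℕ) + 1 = i then Real.sin (t * ((j : ℕ) + 1)) else 0) := by
    intro j
    split_ifs <;> first | omega | simp
  have s1 : ∑ j : Fin N, (if (j : ℕ) = i + 1 then Real.sin (t * ((j : ℕ) + 1)) else 0)
      = Real.sin (t * ((i : ℕ) + 2)) := by
    rw [Fin.sum_univ_eq_sum_range
      (fun j => if j = (i : ℕ) + 1 then Real.sin (t * ((j : ℝ) + 1)) else 0),
      Finset.sum_ite_eq']
    split_ifs with h
    · push_cast; ring_nf
    · have : (i : ℕ) + 1 = N := by
        have := i.2
        simp at h
        omega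
      have h2 : ((i : ℕ) : ℝ) + 2 = N + 1 := by
          have h3 : ((i : ℕ) : ℝ) + 1 = N := by exact_mod_cast this
          linarith
      rw [h2, htN, Real.sin_pi]
  have s2 : ∑ j : Fin N, (if (j : ℕ) + 1 = i then Real.sin (t * ((j : ℕ) + 1)) else 0)
      = Real.sin (t * (i : ℕ)) := by
    rw [Fin.sum_univ_eq_sum_range
      (fun j => if j + 1 = (i : ℕ) then Real.sin (t * ((j : ℝ) + 1)) else 0)]
    obtain ⟨i, hi⟩ := i
    cases i with
    | zero => simp
    | succ k =>
      simp only [Nat.add_right_cancel_iff, Finset.sum_ite_eq']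
      rw [if_pos (by simp; omega)]
      rw [Nat.cast_succ]
  have e : ∀ a b : ℝ, Real.sin (a + b) + Real.sin (a - b) = 2 * Real.cos b * Real.sin a := by
    intro a b
    rw [Real.sin_add, Real.sin_sub]; ring
  have := e (t * ((i : ℕ) + 1)) t
  rw [← this, show t * ((i : ℕ) + 1) + t = t * ((i : ℕ) + 2) by ring,
    show t * ((i : ℕ) + 1) - t = t * (i : ℕ) by ring, ← s1, ← s2, ← Finset.sum_add_distrib]
  refine Finset.sum_congr rfl fun j _ => ?_
  exact key j

theorem kappa_path (N : ℕ) (hN : 0 < N) : kappa (2 * Real.cos (Real.pi / (N + 1))) < ⊤ := by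
  rw [kappa_lt_top_iff]
  have : Nonempty (Fin N) := ⟨⟨0, hN⟩⟩
  have hN1 : (0 : ℝ) < N + 1 := by positivity
  have htpos : 0 < Real.pi / ((N : ℝ) + 1) := div_pos Real.pi_pos hN1
  have htN : Real.pi / ((N : ℝ) + 1) * (N + 1) = Real.pi := by field_simp
  generalize Real.pi / ((N : ℝ) + 1) = t at htpos htN ⊢
  have hp : ∀ j : Fin N, 0 < Real.sin (t * ((j : ℕ) + 1)) := by
    intro j
    have hj : ((j : ℕ) : ℝ) < N := by exact_mod_cast j.2
    have h1 : 0 < t * ((j : ℕ) + 1) := by positivity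
    have h2 : t * ((j : ℕ) + 1) < Real.pi := by nlinarith
    exact Real.sin_pos_of_pos_of_lt_pi h1 h2
  refine ⟨N, SimpleGraph.pathGraph N, ?_⟩
  apply specRad_of_pos (SimpleGraph.pathGraph N) (fun j => Real.sin (t * ((j : ℕ) + 1))) hp
    (2 * Real.cos t)
  intro i
  refine Eq.trans (Finset.sum_congr rfl fun j _ => ?_) (path_sum N t htN i)
  by_cases hh : (i : ℕ) + 1 = j ∨ (j : ℕ) + 1 = i
  · rw [if_pos hh, if_pos (SimpleGraph.pathGraph_adj.mpr hh)]
  · rw [if_neg hh, if_neg (fun h => hh (SimpleGraph.pathGraph_adj.mp h))]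

theorem forward (lam : ℝ) (hpos : 0 < lam) (n : ℕ) (G : SimpleGraph (Fin n))
    (hG : specRad G = lam) : IsTotallyRealAlgInt lam ∧
        ∀ z : ℂ, Polynomial.aeval z (minpoly ℚ lam) = 0 → ‖z‖ ≤ lam := by
  let := Classical.decRel G.Adj
  set A : Matrix (Fin n) (Fin n) ℝ := G.adjMatrix ℝ with hA
  set B : Matrix (Fin n) (Fin n) ℤ := G.adjMatrix ℤ with hB
  have hherm : A.IsHermitian := by
    rw [Matrix.IsHermitian, Matrix.conjTranspose_eq_transpose_of_trivial]
    exact G.isSymm_adjMatrix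
  have hAB : B.map (Int.castRingHom ℝ) = A := by
    ext i j
    simp [hA, hB, SimpleGraph.adjMatrix_apply]
  have hcp : A.charpoly = B.charpoly.map (Int.castRingHom ℝ) := by
    rw [← hAB, Matrix.charpoly_map]
  set S : Set ℝ := {μ : ℝ | Module.End.HasEigenvalue (Matrix.toLin' A) μ} with hS
  have hsup : sSup S = lam := hG
  have hfin : S.Finite := Module.End.finite_hasEigenvalue _
  have hne : S.Nonempty := by
    by_contra h
    rw [Set.not_nonempty_iff_eq_empty] at h
    rw [h, Real.sSup_empty] at hsup
    exact hpos.ne hsup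
  have hmem : lam ∈ S := hsup ▸ hne.csSup_mem hfin
  have hub : ∀ μ ∈ S, μ ≤ lam := fun μ hμ => hsup ▸ le_csSup hfin.bddAbove hμ
  have eigS : ∀ (M : Matrix (Fin n) (Fin n) ℝ) (hM : M.IsHermitian) (i : Fin n),
      ∃ w : Fin n → ℝ, w ≠ 0 ∧ M.mulVec w = hM.eigenvalues i • w := by
    intro M hM i
    refine ⟨_, ?_, hM.mulVec_eigenvectorBasis i⟩
    intro h
    have := hM.eigenvectorBasis.orthonormal.ne_zero i
    apply this
    ext k
    exact congrFun h k
  have memS : ∀ (μ : ℝ) (w : Fin n → ℝ), w ≠ 0 → A.mulVec w = μ • w → μ ∈ S := by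
    intro μ w h0 hw
    refine Module.End.hasEigenvalue_of_hasEigenvector (x := w) ⟨?_, h0⟩
    rw [Module.End.mem_eigenspace_iff, Matrix.toLin'_apply, hw]
  have hH2 : (lam • (1 : Matrix (Fin n) (Fin n) ℝ) - A).IsHermitian := by
    apply Matrix.IsHermitian.sub _ hherm
    rw [Matrix.IsHermitian, Matrix.conjTranspose_eq_transpose_of_trivial]
    simp
  have hpsd : (lam • (1 : Matrix (Fin n) (Fin n) ℝ) - A).PosSemidef := by
    rw [hH2.posSemidef_iff_eigenvalues_nonneg]
    intro i
    obtain ⟨w, hw0, hw⟩ := eigS _ hH2 i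
    have : A.mulVec w = (lam - hH2.eigenvalues i) • w := by
      rw [Matrix.sub_mulVec, Matrix.smul_mulVec, Matrix.one_mulVec] at hw
      rw [sub_smul, ← hw]; abel
    have := hub _ (memS _ w hw0 this)
    simp only [Pi.zero_apply]
    linarith
  have hray : ∀ x : Fin n → ℝ, x ⬝ᵥ A.mulVec x ≤ lam * (x ⬝ᵥ x) := by
    intro x
    have := hpsd.dotProduct_mulVec_nonneg x
    rw [Matrix.sub_mulVec, Matrix.smul_mulVec, Matrix.one_mulVec, dotProduct_sub,
      dotProduct_smul] at this
    simpa using this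
  have habs : ∀ μ ∈ S, |μ| ≤ lam := by
    intro μ hμ
    obtain ⟨u, hu, hu0⟩ := Module.End.HasEigenvalue.exists_hasEigenvector hμ
    rw [Module.End.mem_eigenspace_iff, Matrix.toLin'_apply] at hu
    have hAn : ∀ i j, 0 ≤ A i j := by
      intro i j
      rw [hA, SimpleGraph.adjMatrix_apply]
      split_ifs <;> norm_num
    have h1 := hray (fun i => |u i|)
    have h2 : ((fun i => |u i|) ⬝ᵥ fun i => |u i|) = u ⬝ᵥ u := by
      simp [dotProduct]
    have hp : 0 < u ⬝ᵥ u := by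
      rcases (dotProduct_self_eq_zero (v := u)).not.mpr hu0 |> fun h => lt_or_gt_of_ne h with h | h
      · exfalso
        have : 0 ≤ u ⬝ᵥ u := Finset.sum_nonneg fun i _ => mul_self_nonneg _
        linarith
      · exact h
    have h3 : |μ| * (u ⬝ᵥ u) ≤ (fun i => |u i|) ⬝ᵥ A.mulVec (fun i => |u i|) := by
      have : |μ| * (u ⬝ᵥ u) = |u ⬝ᵥ A.mulVec u| := by
        rw [hu, dotProduct_smul, smul_eq_mul, abs_mul, abs_of_pos hp]
      rw [this]
      simp only [dotProduct, Matrix.mulVec]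
      refine (Finset.abs_sum_le_sum_abs _ _).trans (Finset.sum_le_sum fun i _ => ?_)
      rw [abs_mul]
      refine mul_le_mul_of_nonneg_left ?_ (abs_nonneg _)
      refine (Finset.abs_sum_le_sum_abs _ _).trans (Finset.sum_le_sum fun j _ => ?_)
      rw [abs_mul, abs_of_nonneg (hAn i j)]
    rw [h2] at h1
    exact le_of_mul_le_mul_right (h3.trans h1) hp
  have hroots : ∀ z : ℂ, aeval z B.charpoly = 0 → ∃ μ ∈ S, z = (μ : ℂ) := by
    intro z hz
    have : aeval z A.charpoly = 0 := by
      rw [hcp]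
      rw [← hz]
      simp [aeval_def, eval₂_map]
      congr 1
      
    rw [hherm.charpoly_eq, map_prod, Finset.prod_eq_zero_iff] at this
    obtain ⟨i, -, hi⟩ := this
    obtain ⟨w, hw0, hw⟩ := eigS _ hherm i
    refine ⟨hherm.eigenvalues i, memS _ w hw0 hw, ?_⟩
    simpa [sub_eq_zero] using hi
  have hlamroot : aeval lam B.charpoly = 0 := by
    have h1 : aeval lam A.charpoly = 0 := by
      have h2 := (Module.End.hasEigenvalue_iff_isRoot_charpoly _ _).mp hmem
      rw [Matrix.charpoly_toLin'] at h2
      simpa [IsRoot] using h2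
    rw [hcp] at h1
    simpa [aeval_def, eval₂_map, eval_map] using h1
  refine ⟨⟨B.charpoly, Matrix.charpoly_monic _, hlamroot, ?_⟩, ?_⟩
  · intro z hz
    obtain ⟨μ, -, rfl⟩ := hroots z hz
    simp
  · intro z hz
    have hd : minpoly ℚ lam ∣ B.charpoly.map (Int.castRingHom ℚ) := by
      apply minpoly.dvd
      rw [← hlamroot]
      simp [aeval_def, eval₂_map]
      congr 1
    have : aeval z B.charpoly = 0 := by
      have h := aeval_eq_zero_of_dvd_aeval_eq_zero hd hz
      rw [← h]
      simp [aeval_def, eval₂_map]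
      congr 1
    obtain ⟨μ, hμ, rfl⟩ := hroots z this
    simpa using habs μ hμ

theorem norm_eq_one_aux (w : ℂ) (t : ℝ) (hw : w ≠ 0) (ht : |t| ≤ 2) (h : w + w⁻¹ = (t : ℂ)) :
    ‖w‖ = 1 := by
  have h1 : w * w + 1 = t * w := by
    rw [← h]; field_simp
  have hr := congrArg Complex.re h1
  have hi := congrArg Complex.im h1
  simp at hr hi
  have hn : Complex.normSq w = 1 := by
    rw [Complex.normSq_apply]
    by_cases hb : w.im = 0
    · rw [hb] at hr ⊢
      obtain ⟨h3, h4⟩ := abs_le.mp ht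
      have h5 : (w.re - t / 2) ^ 2 ≤ 0 := by nlinarith
      have h6 : w.re - t / 2 = 0 := by
        have := le_antisymm h5 (sq_nonneg _)
        exact pow_eq_zero_iff (two_ne_zero) |>.mp this
      have h7 : t = 2 * w.re := by linarith
      rw [h7] at hr
      nlinarith
    · have h3 : t = 2 * w.re := by
        have : w.im * (t - 2 * w.re) = 0 := by linarith
        rcases mul_eq_zero.mp this with h | h
        · exact absurd h hb
        · linarith
      rw [h3] at hr
      nlinarith
  rw [Complex.normSq_eq_norm_sq] at hn
  have := norm_nonneg w
  nlinarith

theorem kron_aux (lam : ℝ) (hle : lam ≤ 2) (hInt : IsIntegral ℤ lam)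
    (hreal : ∀ z : ℂ, aeval z (minpoly ℚ lam) = 0 → z.im = 0)
    (hdom : ∀ z : ℂ, aeval z (minpoly ℚ lam) = 0 → ‖z‖ ≤ lam)
    (z : ℂ) (hz0 : z ≠ 0) (hz : z + z⁻¹ = (lam : ℂ)) : ∃ n, 0 < n ∧ IsPrimitiveRoot z n := by
  have hlamC : IsIntegral ℤ (lam : ℂ) := hInt.map (Complex.ofRealHom.toIntAlgHom)
  have hzint : IsIntegral ℤ z := by
    let R := integralClosure ℤ ℂ
    let l : R := ⟨lam, hlamC⟩
    apply isIntegral_trans (A := R)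
    refine ⟨X ^ 2 - C l * X + 1, ?_, ?_⟩
    · monicity!
    · have hl : algebraMap R ℂ l = lam := rfl
      simp only [eval₂_add, eval₂_sub, eval₂_pow, eval₂_X, eval₂_mul, eval₂_C, eval₂_one, hl]
      rw [← hz]
      field_simp
      ring
  have hlamroot : aeval (z + z⁻¹) (minpoly ℚ lam) = 0 := by
    rw [hz]
    have := minpoly.aeval ℚ lam
    have h2 := congrArg Complex.ofReal this
    rw [Complex.ofReal_zero] at h2
    rw [← h2]
    exact aeval_algHom_apply (Complex.ofRealHom.toRatAlgHom) lam (minpoly ℚ lam)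
  let K := IntermediateField.adjoin ℚ {z}
  let : NumberField K := {
    to_charZero := K.charZero,
    to_finiteDimensional := IntermediateField.adjoin.finiteDimensional hzint.tower_top }
  let y : K := ⟨z, IntermediateField.mem_adjoin_simple_self ℚ z⟩
  have hy : aeval (y + y⁻¹) (minpoly ℚ lam) = 0 := by
    apply (algebraMap K ℂ).injective
    rw [map_zero, ← hlamroot]
    exact (aeval_algHom_apply (IsScalarTower.toAlgHom ℚ K ℂ) (y + y⁻¹) (minpoly ℚ lam)).symm
  have hy0 : y ≠ 0 := by
    intro h
    exact hz0 (congrArg (algebraMap K ℂ) h)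
  have : ∃ (n : ℕ) (_ : 0 < n), y ^ n = 1 := by
    refine NumberField.Embeddings.pow_eq_one_of_norm_eq_one (x := y) K ℂ
      (IntermediateField.coe_isIntegral_iff.mp hzint) fun φ => ?_
    have hφ : aeval (φ y + (φ y)⁻¹) (minpoly ℚ lam) = 0 := by
      have h3 := aeval_algHom_apply (φ.toRatAlgHom) (y + y⁻¹) (minpoly ℚ lam)
      rw [hy, map_zero] at h3
      rw [← h3]
      simp
    have him := hreal _ hφ
    have hno := hdom _ hφ
    have hre : φ y + (φ y)⁻¹ = ((φ y + (φ y)⁻¹).re : ℂ) := by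
      apply Complex.ext <;> simp only [Complex.ofReal_re, Complex.ofReal_im, him]
    refine norm_eq_one_aux (φ y) _ ((map_ne_zero φ).mpr hy0) ?_ hre
    exact (Complex.abs_re_le_norm _).trans (hno.trans hle)
  obtain ⟨n, hn0, hn⟩ := this
  have hzn : z ^ n = 1 := congrArg (algebraMap K ℂ) hn
  exact IsPrimitiveRoot.exists_pos hzn hn0.ne'

theorem conj_aux (lam : ℝ) (z w : ℂ) (n : ℕ) (hn : 0 < n) (hz : z + z⁻¹ = (lam : ℂ))
    (hzp : IsPrimitiveRoot z n) (hwp : IsPrimitiveRoot w n) :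
    aeval (w + w⁻¹) (minpoly ℚ lam) = 0 := by
  have hinv : ∀ u : ℂ, IsPrimitiveRoot u n → u⁻¹ = u ^ (n - 1) := by
    intro u hu
    have h0 : u ≠ 0 := hu.ne_zero hn.ne'
    apply inv_eq_of_mul_eq_one_right
    rw [← pow_succ', Nat.sub_add_cancel hn, hu.pow_eq_one]
  have hlamroot : aeval (z + z⁻¹) (minpoly ℚ lam) = 0 := by
    rw [hz]
    have := minpoly.aeval ℚ lam
    have h2 := congrArg Complex.ofReal this
    rw [Complex.ofReal_zero] at h2
    rw [← h2]
    exact aeval_algHom_apply (Complex.ofRealHom.toRatAlgHom) lam (minpoly ℚ lam)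
  have hc : ∀ u : ℂ, IsPrimitiveRoot u n →
      aeval u ((minpoly ℚ lam).comp (X + X ^ (n - 1))) = aeval (u + u⁻¹) (minpoly ℚ lam) := by
    intro u hu
    rw [aeval_comp, hinv u hu]
    simp
  have hd : minpoly ℚ z ∣ (minpoly ℚ lam).comp (X + X ^ (n - 1)) := by
    apply minpoly.dvd
    rw [hc z hzp, hlamroot]
  rw [← cyclotomic_eq_minpoly_rat hzp hn, cyclotomic_eq_minpoly_rat hwp hn] at hd
  rw [← hc w hwp]
  exact aeval_eq_zero_of_dvd_aeval_eq_zero hd (minpoly.aeval ℚ w)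

theorem exp_aux (k n : ℕ) : Complex.exp (2 * Real.pi * Complex.I * ((k : ℂ) / n)) +
    (Complex.exp (2 * Real.pi * Complex.I * ((k : ℂ) / n)))⁻¹ =
      ((2 * Real.cos (2 * Real.pi * k / n) : ℝ) : ℂ) := by
  rw [← Complex.exp_neg]
  push_cast
  rw [Complex.two_cos]
  congr 2 <;> ring

theorem cos_aux (n k : ℕ) (hk : 1 ≤ k) (hkn : k < n) :
    Real.cos (2 * Real.pi * k / n) ≤ Real.cos (2 * Real.pi / n) := by
  have hn : (0 : ℝ) < n := by exact_mod_cast (by omega : 0 < n)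
  have hpi := Real.pi_pos
  have main : ∀ j : ℕ, 1 ≤ j → 2 * j ≤ n →
      Real.cos (2 * Real.pi * j / n) ≤ Real.cos (2 * Real.pi / n) := by
    intro j hj hjn
    have hj' : (1 : ℝ) ≤ j := by exact_mod_cast hj
    have hjn' : (2 : ℝ) * j ≤ n := by exact_mod_cast hjn
    apply Real.cos_le_cos_of_nonneg_of_le_pi
    · positivity
    · rw [div_le_iff₀ hn]; nlinarith
    · apply div_le_div_of_nonneg_right _ hn.le
      nlinarith
  rcases le_or_gt (2 * k) n with h | h
  · exact main k hk h
  · have := main (n - k) (by omega) (by omega)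
    rw [Nat.cast_sub hkn.le] at this
    rw [← Real.cos_two_pi_sub]
    convert this using 2
    field_simp

theorem backward (lam : ℝ) (hpos : 0 < lam) (hle : lam ≤ 2) (h1 : IsTotallyRealAlgInt lam)
    (hdom : ∀ z : ℂ, aeval z (minpoly ℚ lam) = 0 → ‖z‖ ≤ lam) : kappa lam < ⊤ := by
  obtain ⟨p, hpm, hp0, hpr⟩ := h1
  have hInt : IsIntegral ℤ lam := ⟨p, hpm, hp0⟩
  have hreal : ∀ z : ℂ, aeval z (minpoly ℚ lam) = 0 → z.im = 0 := by
    intro z hz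
    have hd : minpoly ℚ lam ∣ p.map (Int.castRingHom ℚ) := by
      apply minpoly.dvd
      rw [← hp0]
      exact aeval_map_algebraMap ℚ lam p
    apply hpr
    have h := aeval_eq_zero_of_dvd_aeval_eq_zero hd hz
    rw [← h]
    exact (aeval_map_algebraMap ℚ z p).symm
  set θ := Real.arccos (lam / 2) with hθ
  have hcos : 2 * Real.cos θ = lam := by
    rw [hθ, Real.cos_arccos (by linarith) (by linarith)]; ring
  have hz : Complex.exp (θ * Complex.I) + (Complex.exp (θ * Complex.I))⁻¹ = (lam : ℂ) := by
    rw [← Complex.exp_neg, ← hcos]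
    push_cast
    rw [Complex.two_cos]
    congr 2; ring
  obtain ⟨n, hn, hprim⟩ := kron_aux lam hle hInt hreal hdom _ (Complex.exp_ne_zero _) hz
  obtain ⟨k, hkn, hcop, hk⟩ := (Complex.isPrimitiveRoot_iff _ n hn.ne').mp hprim
  have hlam : lam = 2 * Real.cos (2 * Real.pi * k / n) := by
    have := exp_aux k n
    rw [hk, hz] at this
    exact_mod_cast this
  have hconj : ∀ j : ℕ, j.Coprime n → |2 * Real.cos (2 * Real.pi * j / n)| ≤ lam := by
    intro j hj
    have hw := Complex.isPrimitiveRoot_exp_of_coprime j n hn.ne' hj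
    have h3 := hdom _ (conj_aux lam _ _ n hn hz hprim hw)
    rw [exp_aux, Complex.norm_real] at h3
    exact h3
  have hnR : (0 : ℝ) < n := by exact_mod_cast hn
  have hpi := Real.pi_pos
  by_cases hn1 : n = 1
  · have : k = 0 := by omega
    have : lam = 2 := by rw [hlam, this]; simp
    rw [this]
    exact kappa_two
  have hk1 : 1 ≤ k := by
    rcases Nat.eq_zero_or_pos k with h | h
    · rw [h, Nat.coprime_zero_left] at hcop
      exact absurd hcop hn1
    · exact h
  have hcl := cos_aux n k hk1 hkn
  rcases Nat.even_or_odd' n with ⟨m, hm | hm⟩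
  · have h4 := hconj 1 (Nat.coprime_one_left n)
    rw [Nat.cast_one, mul_one] at h4
    have h5 := (le_abs_self _).trans h4
    have h6 : lam = 2 * Real.cos (Real.pi / m) := by
      have : 2 * Real.pi / n = Real.pi / m := by
        rw [hm]; push_cast
        rw [mul_div_mul_left _ _ two_ne_zero]
      rw [← this]
      linarith
    have hm2 : 2 ≤ m := by
      by_contra hc
      have : m = 1 := by omega
      rw [this] at h6
      simp at h6
      linarith
    obtain ⟨N, rfl⟩ : ∃ N, m = N + 1 := ⟨m - 1, by omega⟩
    rw [h6]
    have := kappa_path N (by omega)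
    push_cast
    exact this
  · exfalso
    have hm1 : 1 ≤ m := by omega
    have hmc : m.Coprime n := by
      rw [hm]
      simp
    have h4 := hconj m hmc
    have h5 : Real.cos (2 * Real.pi * m / n) = - Real.cos (Real.pi / n) := by
      rw [← Real.cos_pi_sub]
      congr 1
      have : (n : ℝ) = 2 * m + 1 := by rw [hm]; push_cast; ring
      field_simp
      rw [this]; ring
    rw [h5] at h4
    have h6 := (neg_le_abs _).trans h4
    have h7 : Real.cos (2 * Real.pi / n) < Real.cos (Real.pi / n) := by
      apply Real.cos_lt_cos_of_nonneg_of_le_pi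
      · positivity
      · rw [div_le_iff₀ hnR]
        have : (2 : ℝ) ≤ n := by exact_mod_cast (by omega : 2 ≤ n)
        nlinarith
      · gcongr; linarith
    linarith

/-- For `0 < λ ≤ 2`, we have `κ(λ) < ∞` if and only if `λ` is a totally real algebraic
integer which dominates the absolute values of all of its algebraic conjugates. -/
theorem kappa_finite_iff_of_le_two (lam : ℝ) (hpos : 0 < lam) (hle : lam ≤ 2) :
    kappa lam < ⊤ ↔
      (IsTotallyRealAlgInt lam ∧
        ∀ z : ℂ, Polynomial.aeval z (minpoly ℚ lam) = 0 → ‖z‖ ≤ lam) := by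
  constructor
  · intro h
    obtain ⟨n, G, hG⟩ := (kappa_lt_top_iff lam).mp h
    exact forward lam hpos n G hG
  · rintro ⟨h1, h2⟩
    exact backward lam hpos hle h1 h2
end

section
/- Let λ be a real number with 0 < λ < 2 such that λ is a totally real algebraic integer and λ is greater than or equal to the absolute value of every algebraic conjugate of λ. Then there exists an integer n ≥ 2 such that λ = 2cos(π/n). -/
open Polynomial

/-- If `0 < λ < 2` is a totally real algebraic integer dominating the absolute values of
all of its algebraic conjugates, then `λ = 2 cos(π/n)` for some integer `n ≥ 2`. -/
theorem eq_two_cos_pi_div_of_lt_two (lam : ℝ) (h0 : 0 < lam) (h2 : lam < 2)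
    (htot : IsTotallyRealAlgInt lam)
    (hconj : ∀ z : ℂ, Polynomial.aeval z (minpoly ℚ lam) = 0 → ‖z‖ ≤ lam) :
    ∃ n : ℕ, 2 ≤ n ∧ lam = 2 * Real.cos (Real.pi / (n : ℝ)) := by
  obtain ⟨p, hpm, hp0, hpre⟩ := htot
  have hlamInt : IsIntegral ℤ lam := ⟨p, hpm, by simpa [aeval_def] using hp0⟩
  have hdvd : minpoly ℚ lam ∣ p.map (algebraMap ℤ ℚ) :=
    minpoly.dvd _ _ (by rw [aeval_map_algebraMap]; exact hp0)
  have hreal : ∀ z : ℂ, aeval z (minpoly ℚ lam) = 0 → z.im = 0 := by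
    intro z hz
    apply hpre
    have := aeval_eq_zero_of_dvd_aeval_eq_zero hdvd hz
    rwa [aeval_map_algebraMap] at this
  set θ := Real.arccos (lam / 2) with hθ
  have hcos : Real.cos θ = lam / 2 := Real.cos_arccos (by linarith) (by linarith)
  set z : ℂ := Complex.exp (θ * Complex.I) with hz
  have hz0 : z ≠ 0 := Complex.exp_ne_zero _
  have hsum : z + z⁻¹ = (lam : ℂ) := by
    have h1 : (lam : ℂ) = 2 * Complex.cos θ := by
      rw [← Complex.ofReal_cos, hcos]; push_cast; ring
    rw [h1, Complex.two_cos, hz, ← Complex.exp_neg, neg_mul]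
  have hintC : IsIntegral ℤ (lam : ℂ) := hlamInt.map (Complex.ofRealHom.toIntAlgHom)
  have hzint : IsIntegral ℤ z := by
    have hA : IsIntegral (integralClosure ℤ ℂ) z := by
      refine ⟨X ^ 2 - C ⟨(lam : ℂ), hintC⟩ * X + 1, by monicity!, ?_⟩
      have : z ^ 2 - (lam : ℂ) * z + 1 = 0 := by
        rw [← hsum]; field_simp; ring
      simpa [eval₂_add, eval₂_sub] using this
    exact isIntegral_trans z hA
  let K := IntermediateField.adjoin ℚ {z}
  have hzQ : IsIntegral ℚ z := hzint.tower_top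
  have : FiniteDimensional ℚ K := IntermediateField.adjoin.finiteDimensional hzQ
  have : NumberField K := ⟨⟩
  let y : K := IntermediateField.AdjoinSimple.gen ℚ z
  have hy : (algebraMap K ℂ) y = z := IntermediateField.AdjoinSimple.algebraMap_gen ℚ z
  have hinj : Function.Injective (algebraMap K ℂ) := (algebraMap K ℂ).injective
  have hy0 : y ≠ 0 := fun h => hz0 (by rw [← hy, h, map_zero])
  have hyint : IsIntegral ℤ y := by
    rw [← isIntegral_algebraMap_iff hinj, hy]; exact hzint
  have hmin : minpoly ℚ (y + y⁻¹) = minpoly ℚ lam := by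
    rw [← minpoly.algebraMap_eq hinj, map_add, map_inv₀, hy, hsum]
    exact minpoly.algebraMap_eq (B := ℝ) (B' := ℂ) (algebraMap ℝ ℂ).injective lam
  have hroot : ∀ φ : K →+* ℂ, aeval (φ y + (φ y)⁻¹) (minpoly ℚ lam) = 0 := by
    intro φ
    have h := minpoly.aeval ℚ (y + y⁻¹)
    rw [hmin] at h
    have h3 := congrArg φ.toRatAlgHom h
    rw [← aeval_algHom_apply] at h3
    simpa using h3
  have hnorm : ∀ φ : K →+* ℂ, ‖φ y‖ = 1 := by
    intro φ
    have hr := hroot φ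
    have him := hreal _ hr
    have hle := hconj _ hr
    have hne : φ y ≠ 0 := by simpa using hy0
    generalize φ y = t at *
    obtain ⟨m, hm⟩ : ∃ m : ℝ, t + t⁻¹ = m := ⟨_, (Complex.conj_eq_iff_real.1 (Complex.conj_eq_iff_im.2 him)).choose_spec⟩
    rw [hm, Complex.norm_real, Real.norm_eq_abs] at hle
    have hq : t * t - m * t + 1 = 0 := by
      rw [← hm]; field_simp; ring
    have h1 := congrArg Complex.re hq
    have h2' := congrArg Complex.im hq
    simp at h1 h2'
    have hab := abs_le.1 hle
    have hb : t.im ≠ 0 := by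
      intro hb
      rw [hb] at h1
      nlinarith [sq_nonneg (t.re - m/2)]
    have hm2 : m = 2 * t.re := by
      apply mul_right_cancel₀ hb; linarith
    have : ‖t‖ ^ 2 = 1 := by
      rw [Complex.sq_norm, Complex.normSq_apply]; rw [hm2] at h1; linarith
    exact (pow_eq_one_iff_of_nonneg (norm_nonneg _) two_ne_zero).1 this
  obtain ⟨N, hN, hyN⟩ := NumberField.Embeddings.pow_eq_one_of_norm_eq_one K ℂ hyint hnorm
  have hfin : IsOfFinOrder (y ^ 2) := (isOfFinOrder_iff_pow_eq_one.2 ⟨N, hN, hyN⟩).pow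
  set n := orderOf (y ^ 2) with hn
  have hn0 : 0 < n := hfin.orderOf_pos
  have : NeZero n := ⟨hn0.ne'⟩
  have hprim : IsPrimitiveRoot (y ^ 2) n := IsPrimitiveRoot.orderOf _
  have hlamsq : ((lam : ℂ)) ^ 2 = 2 + z ^ 2 + (z ^ 2)⁻¹ := by
    rw [← hsum]; field_simp; ring
  have hn1 : n ≠ 1 := by
    intro h
    have h1 : y ^ 2 = 1 := by
      have := hprim.pow_eq_one
      rwa [h, pow_one] at this
    have h3 : z ^ 2 = 1 := by rw [← hy, ← map_pow, h1, map_one]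
    rw [h3] at hlamsq
    have : lam ^ 2 = 4 := by
      have h4 : ((lam ^ 2 : ℝ) : ℂ) = ((4 : ℝ) : ℂ) := by push_cast; rw [hlamsq]; norm_num
      exact_mod_cast h4
    nlinarith
  have hn2 : 2 ≤ n := by omega
  refine ⟨n, hn2, ?_⟩
  have hnR : (2 : ℝ) ≤ n := by exact_mod_cast hn2
  have hnpos : (0 : ℝ) < n := by linarith
  have hcn : 0 ≤ Real.cos (Real.pi / n) := by
    apply Real.cos_nonneg_of_mem_Icc
    constructor
    · have : 0 ≤ Real.pi / n := by positivity
      linarith [Real.pi_pos]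
    · exact div_le_div_of_nonneg_left Real.pi_pos.le (by norm_num) hnR
  apply le_antisymm
  · have hprimC : IsPrimitiveRoot (z ^ 2) n := by
      rw [← hy, ← map_pow]; exact hprim.map_of_injective hinj
    obtain ⟨k, hk, hkc, hkz⟩ := (Complex.isPrimitiveRoot_iff _ _ hn0.ne').1 hprimC
    have hk0 : 0 < k := by
      rcases Nat.eq_zero_or_pos k with h | h
      · subst h; simp at hkc; exact absurd hkc hn1
      · exact h
    have hre : Real.cos (2 * θ) = Real.cos (2 * Real.pi * k / n) := by
      have h1 : Complex.exp ((2 * Real.pi * k / n : ℝ) * Complex.I)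
          = Complex.exp ((2 * θ : ℝ) * Complex.I) := by
        have : z ^ 2 = Complex.exp ((2 * θ : ℝ) * Complex.I) := by
          rw [hz, ← Complex.exp_nat_mul]; congr 1; push_cast; ring
        rw [← this, ← hkz]; congr 1; push_cast; ring
      have := congrArg Complex.re h1
      rw [Complex.exp_ofReal_mul_I_re, Complex.exp_ofReal_mul_I_re] at this
      exact this.symm
    have hmono : Real.cos (2 * Real.pi * k / n) ≤ Real.cos (2 * (Real.pi / n)) := by
      have key : ∀ j : ℝ, 1 ≤ j → 2 * j ≤ n →
          Real.cos (2 * Real.pi * j / n) ≤ Real.cos (2 * (Real.pi / n)) := by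
        intro j hj hjn
        apply Real.cos_le_cos_of_nonneg_of_le_pi (by positivity)
        · rw [div_le_iff₀ hnpos]; nlinarith [Real.pi_pos]
        · rw [← mul_div_assoc]; exact div_le_div_of_nonneg_right (by nlinarith [Real.pi_pos]) hnpos.le
      have hk1 : (1 : ℝ) ≤ k := by exact_mod_cast hk0
      have hkn : (k : ℝ) + 1 ≤ n := by exact_mod_cast hk
      rcases le_total (2 * (k : ℝ)) n with h | h
      · exact key k hk1 h
      · have := key (n - k) (by linarith) (by linarith)
        rwa [show 2 * Real.pi * (n - k : ℝ) / n = 2 * Real.pi - 2 * Real.pi * k / n by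
          field_simp, Real.cos_two_pi_sub] at this
    rw [← hre, Real.cos_two_mul, Real.cos_two_mul, hcos] at hmono
    refine abs_le_of_sq_le_sq' (?_) (by positivity) |>.2
    nlinarith
  · set u : ℂ := Complex.exp ((Real.pi / n : ℝ) * Complex.I) with hu
    have hu0 : u ≠ 0 := Complex.exp_ne_zero _
    have hζ : IsPrimitiveRoot (u ^ 2) n := by
      have := Complex.isPrimitiveRoot_exp n hn0.ne'
      convert this using 1
      rw [hu, ← Complex.exp_nat_mul]; congr 1; push_cast; ring
    have hmem : u ^ 2 ∈ (minpoly ℚ (y ^ 2)).rootSet ℂ := by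
      rw [← cyclotomic_eq_minpoly_rat hprim hn0, mem_rootSet]
      refine ⟨cyclotomic_ne_zero _ _, ?_⟩
      have := hζ.isRoot_cyclotomic hn0
      simpa [aeval_def, eval₂_eq_eval_map, IsRoot.def] using this
    rw [← NumberField.Embeddings.range_eval_eq_rootSet_minpoly K ℂ] at hmem
    obtain ⟨φ, hφ⟩ := hmem
    have hle := hconj _ (hroot φ)
    have hφ2 : (φ y) ^ 2 = u ^ 2 := by simpa using hφ
    have hcu : u + u⁻¹ = ((2 * Real.cos (Real.pi / n) : ℝ) : ℂ) := by
      rw [Complex.ofReal_mul, Complex.ofReal_cos, Complex.ofReal_ofNat, Complex.two_cos, hu,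
        ← Complex.exp_neg, neg_mul]
    have hnn : ‖φ y + (φ y)⁻¹‖ = 2 * Real.cos (Real.pi / n) := by
      have : ‖u + u⁻¹‖ = 2 * Real.cos (Real.pi / n) := by
        rw [hcu, Complex.norm_real, Real.norm_eq_abs, abs_of_nonneg (by positivity)]
      rcases sq_eq_sq_iff_eq_or_eq_neg.1 hφ2 with h | h
      · rw [h, this]
      · rw [h, inv_neg, ← neg_add, norm_neg, this]
    linarith
end
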